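/- (Local a posteriori null-space error bound, conservative LSPG.) Under the stated hypotheses, the component of the state-space error in the null space of the constraints satisfies ‖Z̄_Pᵀ e^n‖ ≤ Σ_{ℓ=0}^k ε_ℓ ( κ ‖V̄_Pᵀ e^{n−ℓ}‖ + ‖(I_N − P_P) f(x_0 + Φ x̂^{n−ℓ}, t^{n−ℓ})‖ ) + Σ_{ℓ=1}^k γ_ℓ ‖Z̄_Pᵀ e^{n−ℓ}‖. -/

import Mathlib

open Matrix Finset

noncomputable def euclNorm {n : ℕ} (v : Fin n → ℝ) : ℝ := Real.sqrt (∑ i, v i ^ 2)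

theorem euclNorm_eq_norm {n : ℕ} (v : Fin n → ℝ) : euclNorm v = ‖WithLp.toLp 2 v‖ := by
  simp [euclNorm, EuclideanSpace.norm_eq]

theorem euclNorm_nonneg {n : ℕ} (v : Fin n → ℝ) : 0 ≤ euclNorm v := Real.sqrt_nonneg _

theorem euclNorm_add_le {n : ℕ} (v w : Fin n → ℝ) :
    euclNorm (v + w) ≤ euclNorm v + euclNorm w := by
  simpa only [euclNorm_eq_norm, WithLp.toLp_add] using norm_add_le _ _

theorem euclNorm_sub_le {n : ℕ} (v w : Fin n → ℝ) :
    euclNorm (v - w) ≤ euclNorm v + euclNorm w := by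
  simpa only [euclNorm_eq_norm, WithLp.toLp_sub] using norm_sub_le _ _

theorem euclNorm_smul {n : ℕ} (a : ℝ) (v : Fin n → ℝ) :
    euclNorm (a • v) = |a| * euclNorm v := by
  simp only [euclNorm_eq_norm, WithLp.toLp_smul, norm_smul, Real.norm_eq_abs]

theorem euclNorm_sum_le {n : ℕ} {ι : Type*} (s : Finset ι) (v : ι → Fin n → ℝ) :
    euclNorm (∑ i ∈ s, v i) ≤ ∑ i ∈ s, euclNorm (v i) := by
  simpa only [euclNorm_eq_norm, WithLp.toLp_sum] using norm_sum_le _ _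

theorem euclNorm_sq {n : ℕ} (v : Fin n → ℝ) : euclNorm v ^ 2 = v ⬝ᵥ v := by
  rw [euclNorm, Real.sq_sqrt (Finset.sum_nonneg fun i _ => sq_nonneg _)]
  simp [dotProduct, sq]

theorem euclNorm_transpose_mulVec_sq {m n : ℕ} (A : Matrix (Fin m) (Fin n) ℝ) (v : Fin m → ℝ) :
    euclNorm (Aᵀ *ᵥ v) ^ 2 = v ⬝ᵥ (A * Aᵀ) *ᵥ v := by
  rw [euclNorm_sq, ← mulVec_mulVec, dotProduct_mulVec v A, ← mulVec_transpose]

/-- Pythagoras for a pair of frames resolving the identity. -/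
theorem euclNorm_sq_eq_add_of_resolution {m r q : ℕ} {A : Matrix (Fin m) (Fin r) ℝ}
    {B : Matrix (Fin m) (Fin q) ℝ} (hAB : A * Aᵀ + B * Bᵀ = 1) (v : Fin m → ℝ) :
    euclNorm v ^ 2 = euclNorm (Aᵀ *ᵥ v) ^ 2 + euclNorm (Bᵀ *ᵥ v) ^ 2 := by
  rw [euclNorm_transpose_mulVec_sq, euclNorm_transpose_mulVec_sq, ← dotProduct_add,
    ← add_mulVec, hAB, one_mulVec, euclNorm_sq]

theorem euclNorm_le_add_of_resolution {m r q : ℕ} {A : Matrix (Fin m) (Fin r) ℝ}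
    {B : Matrix (Fin m) (Fin q) ℝ} (hAB : A * Aᵀ + B * Bᵀ = 1) (v : Fin m → ℝ) :
    euclNorm v ≤ euclNorm (Aᵀ *ᵥ v) + euclNorm (Bᵀ *ᵥ v) := by
  have hA := euclNorm_nonneg (Aᵀ *ᵥ v)
  have hB := euclNorm_nonneg (Bᵀ *ᵥ v)
  refine abs_le_of_sq_le_sq' ?_ (add_nonneg hA hB) |>.2
  nlinarith [euclNorm_sq_eq_add_of_resolution hAB v, mul_nonneg hA hB]

theorem euclNorm_transpose_mulVec_le_of_resolution {m r q : ℕ} {A : Matrix (Fin m) (Fin r) ℝ}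
    {B : Matrix (Fin m) (Fin q) ℝ} (hAB : A * Aᵀ + B * Bᵀ = 1) (v : Fin m → ℝ) :
    euclNorm (Bᵀ *ᵥ v) ≤ euclNorm v := by
  refine abs_le_of_sq_le_sq' ?_ (euclNorm_nonneg v) |>.2
  nlinarith [euclNorm_sq_eq_add_of_resolution hAB v, sq_nonneg (euclNorm (Aᵀ *ᵥ v))]

/-- The constraint reaction is invisible to any `Z` orthogonal to `Φ * V`, where `V` spans the
right singular space of the projected constraints. -/
theorem transpose_mul_constraint_reaction_eq_zero {N Nb p s q : ℕ}
    {Φ Ψ : Matrix (Fin N) (Fin p) ℝ} {C : Matrix (Fin Nb) (Fin N) ℝ}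
    {W : Matrix (Fin Nb) (Fin s) ℝ} {V : Matrix (Fin p) (Fin s) ℝ}
    {Z : Matrix (Fin N) (Fin q) ℝ}
    (hC : C * Ψ * (Φᵀ * Ψ)⁻¹ = W * Vᵀ) (hZ : Zᵀ * (Φ * V) = 0) :
    Zᵀ * (Φ * ((Ψᵀ * Φ)⁻¹ * Ψᵀ * Cᵀ)) = 0 := by
  have hT : (Ψᵀ * Φ)⁻¹ * Ψᵀ * Cᵀ = V * Wᵀ := by
    simpa [transpose_mul, transpose_nonsing_inv, Matrix.mul_assoc] using congrArg transpose hC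
  rw [hT, ← Matrix.mul_assoc Φ, ← Matrix.mul_assoc, hZ, Matrix.zero_mul]

/-- Local a posteriori error bound for the component of the conservative
LSPG state-space error in the null space of the constraints. -/
theorem conservative_lspg_nullspace_error_bound
    (N Nb p k : ℕ) (hN : 0 < N) (hNb : 0 < Nb) (hp : 0 < p) (hk : 1 ≤ k)
    (Φ : Matrix (Fin N) (Fin p) ℝ) (hΦ : Φᵀ * Φ = 1)
    (C : Matrix (Fin Nb) (Fin N) ℝ)
    (Δt : ℝ) (hΔt : 0 < Δt)
    (α β : ℕ → ℝ) (hα0 : α 0 ≠ 0)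
    (t : ℕ → ℝ) (x0 : Fin N → ℝ)
    (f : (Fin N → ℝ) → ℝ → (Fin N → ℝ))
    (κ : ℝ) (hκ : 0 < κ)
    (hLip : ∀ x y s, euclNorm (f x s - f y s) ≤ κ * euclNorm (x - y))
    (h : ℝ) (hdef : h = |α 0| - |β 0| * κ * Δt)
    (hstab : |β 0| * κ * Δt < |α 0|)
    (ε γ : ℕ → ℝ)
    (hε : ∀ ℓ, ε ℓ = |β ℓ| * Δt / h)
    (hγ : ∀ ℓ, γ ℓ = (|α ℓ| + |β ℓ| * κ * Δt) / h)
    (rhat : (ℕ → Fin N → ℝ) → (Fin N → ℝ))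
    (hrhat : ∀ y, rhat y = ∑ ℓ ∈ Finset.Icc 1 k,
      ((β ℓ * Δt) • f (x0 + y ℓ) (t ℓ) - α ℓ • y ℓ))
    (x : ℕ → Fin N → ℝ)
    (hFOM : α 0 • x 0 = (β 0 * Δt) • f (x0 + x 0) (t 0) + rhat x)
    (Ψ : Matrix (Fin N) (Fin p) ℝ) (hinv : IsUnit (Ψᵀ * Φ).det)
    (xh : ℕ → Fin p → ℝ) (lam : Fin Nb → ℝ)
    (hROM : α 0 • xh 0 = (β 0 * Δt) • ((Ψᵀ * Φ)⁻¹ * Ψᵀ).mulVec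
        (f (x0 + Φ.mulVec (xh 0)) (t 0))
      + ((Ψᵀ * Φ)⁻¹ * Ψᵀ).mulVec (rhat (fun ℓ => Φ.mulVec (xh ℓ)))
      - ((Ψᵀ * Φ)⁻¹ * Ψᵀ * Cᵀ).mulVec lam)
    (s : ℕ) (hs : s = (C * Ψ * (Φᵀ * Ψ)⁻¹).rank)
    (U : Matrix (Fin Nb) (Fin s) ℝ) (Sp : Matrix (Fin s) (Fin s) ℝ)
    (V : Matrix (Fin p) (Fin s) ℝ)
    (hU : Uᵀ * U = 1) (hV : Vᵀ * V = 1)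
    (hSdiag : ∀ i j : Fin s, i ≠ j → Sp i j = 0)
    (hSpos : ∀ i : Fin s, 0 < Sp i i)
    (hSVD : C * Ψ * (Φᵀ * Ψ)⁻¹ = U * Sp * Vᵀ)
    (Vb : Matrix (Fin N) (Fin s) ℝ) (hVb : Vb = Φ * V)
    (Z : Matrix (Fin N) (Fin (N - s)) ℝ)
    (hZ : Zᵀ * Z = 1) (hZV : Zᵀ * Vb = 0)
    (hdecomp : Vb * Vbᵀ + Z * Zᵀ = 1)
    (e : ℕ → Fin N → ℝ) (he : ∀ m, e m = x m - Φ.mulVec (xh m)) :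
    euclNorm (Zᵀ.mulVec (e 0)) ≤
      (∑ ℓ ∈ Finset.range (k + 1), ε ℓ * (κ * euclNorm (Vbᵀ.mulVec (e ℓ))
        + euclNorm ((1 - Φ * (Ψᵀ * Φ)⁻¹ * Ψᵀ).mulVec
            (f (x0 + Φ.mulVec (xh ℓ)) (t ℓ)))))
      + ∑ ℓ ∈ Finset.Icc 1 k, γ ℓ * euclNorm (Zᵀ.mulVec (e ℓ)) := by
  have hh : 0 < h := by rw [hdef]; linarith
  set A := (Ψᵀ * Φ)⁻¹ * Ψᵀ with hA
  have hAΦ : A * Φ = 1 := by rw [hA, Matrix.mul_assoc, nonsing_inv_mul _ hinv]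
  have hP : Φ * (Ψᵀ * Φ)⁻¹ * Ψᵀ = Φ * A := by rw [hA, Matrix.mul_assoc]
  rw [hP]
  have hPΦ (y : Fin p → ℝ) : Φ *ᵥ (A *ᵥ (Φ *ᵥ y)) = Φ *ᵥ y := by
    rw [mulVec_mulVec y, hAΦ, one_mulVec]
  have hreact : Zᵀ *ᵥ (Φ *ᵥ ((A * Cᵀ) *ᵥ lam)) = 0 := by
    rw [mulVec_mulVec, mulVec_mulVec, Matrix.mul_assoc,
      transpose_mul_constraint_reaction_eq_zero hSVD (hVb ▸ hZV), zero_mulVec]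
  set d : ℕ → Fin N → ℝ := fun ℓ =>
    f (x0 + x ℓ) (t ℓ) - Φ *ᵥ (A *ᵥ f (x0 + Φ *ᵥ xh ℓ) (t ℓ)) with hd
  have hrdiff : rhat x - Φ *ᵥ (A *ᵥ rhat fun ℓ => Φ *ᵥ xh ℓ) =
      ∑ ℓ ∈ Icc 1 k, ((β ℓ * Δt) • d ℓ - α ℓ • e ℓ) := by
    rw [hrhat, hrhat, mulVec_sum, mulVec_sum, ← Finset.sum_sub_distrib]
    refine Finset.sum_congr rfl fun ℓ _ => ?_
    simp only [mulVec_sub, mulVec_smul, hPΦ, he, hd, smul_sub]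
    abel
  have hstep : α 0 • (Zᵀ *ᵥ e 0) = Zᵀ *ᵥ ((β 0 * Δt) • d 0 +
      ∑ ℓ ∈ Icc 1 k, ((β ℓ * Δt) • d ℓ - α ℓ • e ℓ)) := by
    rw [← hrdiff, ← mulVec_smul, he, smul_sub, ← mulVec_smul, hFOM, hROM]
    simp only [mulVec_add, mulVec_sub, mulVec_smul, hreact, hd, smul_sub]
    abel
  have hd_le (ℓ : ℕ) : euclNorm (Zᵀ *ᵥ d ℓ) ≤
      κ * euclNorm (Vbᵀ *ᵥ e ℓ) + κ * euclNorm (Zᵀ *ᵥ e ℓ) +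
        euclNorm ((1 - Φ * A) *ᵥ f (x0 + Φ *ᵥ xh ℓ) (t ℓ)) := by
    refine (euclNorm_transpose_mulVec_le_of_resolution hdecomp _).trans ?_
    have hsplit : d ℓ = (f (x0 + x ℓ) (t ℓ) - f (x0 + Φ *ᵥ xh ℓ) (t ℓ)) +
        (1 - Φ * A) *ᵥ f (x0 + Φ *ᵥ xh ℓ) (t ℓ) := by
      simp only [hd, sub_mulVec, one_mulVec, mulVec_mulVec]
      abel
    have hL := hLip (x0 + x ℓ) (x0 + Φ *ᵥ xh ℓ) (t ℓ)
    rw [add_sub_add_left_eq_sub, ← he] at hL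
    rw [hsplit]
    refine (euclNorm_add_le _ _).trans ?_
    have := mul_le_mul_of_nonneg_left (euclNorm_le_add_of_resolution hdecomp (e ℓ)) hκ.le
    linarith
  have hβd (ℓ : ℕ) : euclNorm ((β ℓ * Δt) • (Zᵀ *ᵥ d ℓ)) ≤ |β ℓ| * Δt *
      (κ * euclNorm (Vbᵀ *ᵥ e ℓ) + κ * euclNorm (Zᵀ *ᵥ e ℓ) +
        euclNorm ((1 - Φ * A) *ᵥ f (x0 + Φ *ᵥ xh ℓ) (t ℓ))) := by
    rw [euclNorm_smul, abs_mul, abs_of_pos hΔt]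
    exact mul_le_mul_of_nonneg_left (hd_le ℓ) (by positivity)
  set T : ℕ → ℝ := fun ℓ => κ * euclNorm (Vbᵀ *ᵥ e ℓ) +
    euclNorm ((1 - Φ * A) *ᵥ f (x0 + Φ *ᵥ xh ℓ) (t ℓ)) with hT
  have hmain : |α 0| * euclNorm (Zᵀ *ᵥ e 0) ≤
      |β 0| * Δt * (T 0 + κ * euclNorm (Zᵀ *ᵥ e 0)) +
      ∑ ℓ ∈ Icc 1 k, (|β ℓ| * Δt * T ℓ +
        (|α ℓ| + |β ℓ| * κ * Δt) * euclNorm (Zᵀ *ᵥ e ℓ)) := by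
    rw [← euclNorm_smul, hstep, mulVec_add, mulVec_sum, mulVec_smul]
    refine (euclNorm_add_le _ _).trans (add_le_add ((hβd 0).trans_eq (by simp only [hT]; ring))
      ((euclNorm_sum_le _ _).trans (Finset.sum_le_sum fun ℓ _ => ?_)))
    rw [mulVec_sub, mulVec_smul, mulVec_smul]
    refine (euclNorm_sub_le _ _).trans ?_
    rw [euclNorm_smul (α ℓ)]
    refine (add_le_add_left (hβd ℓ) _).trans_eq ?_
    simp only [hT]
    ring
  have hrange : Finset.range (k + 1) = insert 0 (Icc 1 k) := by
    ext i
    simp only [Finset.mem_range, Finset.mem_insert, Finset.mem_Icc]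
    lia
  rw [hrange, Finset.sum_insert (by simp), add_assoc, ← Finset.sum_add_distrib]
  have hscale : |β 0| * Δt / h * T 0 + ∑ ℓ ∈ Icc 1 k, (|β ℓ| * Δt / h * T ℓ +
      (|α ℓ| + |β ℓ| * κ * Δt) / h * euclNorm (Zᵀ *ᵥ e ℓ)) =
      (|β 0| * Δt * T 0 + ∑ ℓ ∈ Icc 1 k, (|β ℓ| * Δt * T ℓ +
        (|α ℓ| + |β ℓ| * κ * Δt) * euclNorm (Zᵀ *ᵥ e ℓ))) / h := by
    rw [add_div, Finset.sum_div]
    congr 1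
    · ring
    · exact Finset.sum_congr rfl fun ℓ _ => by ring
  simp only [hε, hγ]
  refine le_of_le_of_eq ?_ hscale.symm
  rw [le_div_iff₀ hh, hdef]
  linarith
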